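/- Let G be an F_3-free split graph with split partition (K, I), and let D and D' be two vertex-disjoint induced copies of the dart in G, each having exactly three of its vertices in K and two of its vertices in I. Then every vertex of the two-element I-part of D has at least one neighbour and at least one non-neighbour in the three-element K-part of D'. -/

import Mathlib

variable {V : Type*}

/-- `(K, I)` is a split partition of `G`: every vertex is in `K` or `I`, the sets are
disjoint, `K` is a clique and `I` is an independent set. -/
def IsSplitPartition (G : SimpleGraph V) (K I : Set V) : Prop :=
  (∀ v, v ∈ K ∨ v ∈ I) ∧ Disjoint K I ∧
  (∀ u ∈ K, ∀ v ∈ K, u ≠ v → G.Adj u v) ∧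
  (∀ u ∈ I, ∀ v ∈ I, ¬ G.Adj u v)

/-- `G` is `H`-free: there is no induced-subgraph embedding of `H` into `G`,
i.e. no induced subgraph of `G` is isomorphic to `H`. -/
def HFree {W : Type*} (G : SimpleGraph V) (H : SimpleGraph W) : Prop :=
  IsEmpty (H ↪g G)

/-- The bull: vertices a,b,c,d,e = 0,1,2,3,4 with edges ab, bc, ca, ad, be. -/
def bull : SimpleGraph (Fin 5) :=
  SimpleGraph.fromRel (fun u v =>
    (u, v) ∈ ([(0,1),(1,2),(2,0),(0,3),(1,4)] : List (Fin 5 × Fin 5)))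

/-- The dart: vertices a,b,c,d,e = 0,1,2,3,4 with edges ab, bc, ca, ad, be, bd. -/
def dart : SimpleGraph (Fin 5) :=
  SimpleGraph.fromRel (fun u v =>
    (u, v) ∈ ([(0,1),(1,2),(2,0),(0,3),(1,4),(1,3)] : List (Fin 5 × Fin 5)))

/-- `F₁`: a `K₄` on vertices a,b,c,d = 0,1,2,3, a vertex e = 4 adjacent only to a,
and a vertex f = 5 adjacent only to d. -/
def F1 : SimpleGraph (Fin 6) :=
  SimpleGraph.fromRel (fun u v =>
    (u, v) ∈ ([(0,1),(0,2),(0,3),(1,2),(1,3),(2,3),(0,4),(3,5)] : List (Fin 6 × Fin 6)))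

/-- `F₂`: a `K₄` on vertices a,b,c,d = 0,1,2,3, a vertex e = 4 adjacent only to a,
and a vertex f = 5 adjacent only to c and d. -/
def F2 : SimpleGraph (Fin 6) :=
  SimpleGraph.fromRel (fun u v =>
    (u, v) ∈ ([(0,1),(0,2),(0,3),(1,2),(1,3),(2,3),(0,4),(2,5),(3,5)] : List (Fin 6 × Fin 6)))

/-- `F₃`: a `K₄` on vertices a,b,c,d = 0,1,2,3, a vertex z = 4 adjacent only to a and b,
and a vertex y = 5 adjacent only to b. -/
def F3 : SimpleGraph (Fin 6) :=
  SimpleGraph.fromRel (fun u v =>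
    (u, v) ∈ ([(0,1),(0,2),(0,3),(1,2),(1,3),(2,3),(0,4),(1,4),(1,5)] : List (Fin 6 × Fin 6)))

/-- `Q`: vertices j1,j2,j3,i1,i2,i3 = 0,1,2,3,4,5 with edges
j1j2, j1j3, j2j3, i1j1, i2j2, i3j2, i3j3. -/
def Qgraph : SimpleGraph (Fin 6) :=
  SimpleGraph.fromRel (fun u v =>
    (u, v) ∈ ([(0,1),(0,2),(1,2),(3,0),(4,1),(5,1),(5,2)] : List (Fin 6 × Fin 6)))

/-- `K_{1,3} + 2P₁`: a star with centre 0 and leaves 1,2,3, plus isolated vertices 4,5. -/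
def K13_2P1 : SimpleGraph (Fin 6) :=
  SimpleGraph.fromRel (fun u v =>
    (u, v) ∈ ([(0,1),(0,2),(0,3)] : List (Fin 6 × Fin 6)))

/-- A module of `G`: every vertex outside `M` is adjacent to all of `M` or to none of it. -/
def IsModule (G : SimpleGraph V) (M : Set V) : Prop :=
  ∀ v ∉ M, (∀ u ∈ M, G.Adj v u) ∨ (∀ u ∈ M, ¬ G.Adj v u)

/-- `G` is prime: every module of `G` is trivial (has at most one vertex,
or is the whole vertex set). -/
def IsPrime (G : SimpleGraph V) : Prop :=
  ∀ M : Set V, IsModule G M → M.Subsingleton ∨ M = Set.univ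

instance : DecidableRel dart.Adj := fun u v => by
  unfold dart
  infer_instance

/-- In a split partition of the dart whose clique side has three vertices, the clique side
consists of the two vertices of degree at least three and one of the two twins. -/
theorem dart_clique_side_eq (S : Finset (Fin 5)) (hS : S.card = 3)
    (hK : ∀ u ∈ S, ∀ v ∈ S, u ≠ v → dart.Adj u v)
    (hI : ∀ u ∉ S, ∀ v ∉ S, ¬ dart.Adj u v) :
    S = {0, 1, 2} ∨ S = {0, 1, 3} := by
  revert S
  decide

instance : DecidableRel F3.Adj := fun u v => by
  unfold F3
  infer_instance

/-- Nonadjacent vertices of `F₃` are determined by their neighbourhoods. -/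
theorem F3_eq_of_not_adj_of_same_neighbours :
    ∀ i j, ¬ F3.Adj i j → (∀ k, F3.Adj i k ↔ F3.Adj j k) → i = j := by
  decide

/-- An `F₃`-free graph has no six vertices with the adjacencies of `F₃`. -/
theorem HFree.F3_false {G : SimpleGraph V} (hfree : HFree G F3) {a b c d z y : V}
    (hab : G.Adj a b) (hac : G.Adj a c) (had : G.Adj a d) (hbc : G.Adj b c)
    (hbd : G.Adj b d) (hcd : G.Adj c d) (hza : G.Adj z a) (hzb : G.Adj z b)
    (hzc : ¬ G.Adj z c) (hzd : ¬ G.Adj z d) (hya : ¬ G.Adj y a) (hyb : G.Adj y b)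
    (hyc : ¬ G.Adj y c) (hyd : ¬ G.Adj y d) (hzy : ¬ G.Adj z y) : False := by
  have hadj : ∀ i j, G.Adj (![a, b, c, d, z, y] i) (![a, b, c, d, z, y] j) ↔ F3.Adj i j := by
    intro i j
    fin_cases i <;> fin_cases j <;> simp [F3] <;>
      first
      | assumption
      | (rw [G.adj_comm]; assumption)
  have hinj : Function.Injective ![a, b, c, d, z, y] := by
    intro i j hij
    exact F3_eq_of_not_adj_of_same_neighbours i j
      (fun hF => ((hadj i j).2 hF).ne hij) fun k => by rw [← hadj, ← hadj, hij]
  exact hfree.false ⟨⟨_, hinj⟩, hadj _ _⟩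

/-- The clique side `{a, b, c}` and the independent side `{z, y}` of a dart, labelled so that
`z` is adjacent to exactly `a, b` and `y` to exactly `b` on the clique side. -/
theorem exists_dart_labelling {G : SimpleGraph V} {K I : Set V}
    (h : IsSplitPartition G K I) (f : dart ↪g G) (S : Finset (Fin 5)) (hS : S.card = 3)
    (hSK : ∀ v ∈ S, f v ∈ K) (hSI : ∀ v ∉ S, f v ∈ I) :
    ∃ p q : Fin 5, S = {0, 1, p} ∧ (∀ v, v ∉ S ↔ v = q ∨ v = 4) ∧
      dart.Adj 0 1 ∧ dart.Adj 0 p ∧ dart.Adj 1 p ∧ dart.Adj q 0 ∧ dart.Adj q 1 ∧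
      ¬ dart.Adj q p ∧ ¬ dart.Adj 4 0 ∧ dart.Adj 4 1 ∧ ¬ dart.Adj 4 p ∧ ¬ dart.Adj q 4 := by
  obtain ⟨-, -, hK, hI⟩ := h
  rcases dart_clique_side_eq S hS
    (fun u hu v hv huv => f.map_adj_iff.1
      (hK _ (hSK u hu) _ (hSK v hv) (f.injective.ne huv)))
    (fun u hu v hv huv => hI _ (hSI u hu) _ (hSI v hv) (f.map_adj_iff.2 huv)) with rfl | rfl
  · exact ⟨2, 3, by decide⟩
  · exact ⟨3, 2, by decide⟩

/-- In an `F₃`-free split graph, no vertex of the independent side outside a dart is complete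
to the clique side of the dart. -/
theorem exists_nonadj_dart_clique_side {G : SimpleGraph V} {K I : Set V}
    (h : IsSplitPartition G K I) (hfree : HFree G F3) (f : dart ↪g G) (S : Finset (Fin 5))
    (hS : S.card = 3) (hSK : ∀ v ∈ S, f v ∈ K) (hSI : ∀ v ∉ S, f v ∈ I)
    {x : V} (hx : x ∈ I) : ∃ w ∈ S, ¬ G.Adj x (f w) := by
  by_contra! hall
  obtain ⟨p, q, rfl, hout, h01, h0p, h1p, hq0, hq1, hqp, h40, h41, h4p, hq4⟩ :=
    exists_dart_labelling h f S hS hSK hSI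
  simp only [← f.map_adj_iff] at h01 h0p h1p hq0 hq1 hqp h40 h41 h4p hq4
  have hI := h.2.2.2
  exact hfree.F3_false h01 h0p (hall 0 (by simp)).symm h1p (hall 1 (by simp)).symm
    (hall p (by simp)).symm hq0 hq1 hqp (hI _ (hSI q ((hout q).2 (.inl rfl))) _ hx)
    h40 h41 h4p (hI _ (hSI 4 ((hout 4).2 (.inr rfl))) _ hx) hq4

/-- In an `F₃`-free split graph, if a vertex of the independent side of a dart misses a
clique vertex outside the dart, then every other vertex of the independent side of the dart
is adjacent to it. -/
theorem adj_of_not_adj_dart_independent_side {G : SimpleGraph V} {K I : Set V}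
    (h : IsSplitPartition G K I) (hfree : HFree G F3) (f : dart ↪g G) (S : Finset (Fin 5))
    (hS : S.card = 3) (hSK : ∀ v ∈ S, f v ∈ K) (hSI : ∀ v ∉ S, f v ∈ I)
    {x : V} (hx : x ∈ K) (hxf : x ∉ Set.range f) {u v : Fin 5} (hu : u ∉ S) (hv : v ∉ S)
    (huv : u ≠ v) (hux : ¬ G.Adj (f u) x) : G.Adj (f v) x := by
  by_contra hvx
  obtain ⟨p, q, rfl, hout, h01, h0p, h1p, hq0, hq1, hqp, h40, h41, h4p, hq4⟩ :=
    exists_dart_labelling h f S hS hSK hSI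
  simp only [← f.map_adj_iff] at h01 h0p h1p hq0 hq1 hqp h40 h41 h4p hq4
  have hK (i) (hi : i ∈ ({0, 1, p} : Finset (Fin 5))) : G.Adj (f i) x :=
    h.2.2.1 _ (hSK i hi) _ hx fun he => hxf ⟨i, he⟩
  have hqx : ¬ G.Adj (f q) x ∧ ¬ G.Adj (f 4) x := by
    rcases (hout u).1 hu with rfl | rfl <;> rcases (hout v).1 hv with rfl | rfl <;>
      simp_all
  exact hfree.F3_false h01 h0p (hK 0 (by simp)) h1p (hK 1 (by simp)) (hK p (by simp))
    hq0 hq1 hqp hqx.1 h40 h41 h4p hqx.2 hq4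

/-- Let `G` be an `F₃`-free split graph with split partition `(K, I)`, and let `D` (given by
an embedding `f` with `K`-part `S`) and `D'` (given by an embedding `f'` with `K`-part `S'`)
be two vertex-disjoint induced copies of the dart in `G`, each having exactly three of its
vertices in `K` and two of its vertices in `I`. Then every vertex of the two-element `I`-part
of `D` has at least one neighbour and at least one non-neighbour in the three-element
`K`-part of `D'`. -/
theorem F3_free_darts_neighbour_and_nonneighbour (G : SimpleGraph V) (K I : Set V)
    (h : IsSplitPartition G K I) (hfree : HFree G F3)
    (f f' : dart ↪g G) (S S' : Finset (Fin 5))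
    (hdisj : Disjoint (Set.range f) (Set.range f'))
    (hS : S.card = 3) (hSK : ∀ v ∈ S, f v ∈ K) (hSI : ∀ v ∉ S, f v ∈ I)
    (hS' : S'.card = 3) (hSK' : ∀ v ∈ S', f' v ∈ K) (hSI' : ∀ v ∉ S', f' v ∈ I) :
    ∀ v ∉ S, (∃ w ∈ S', G.Adj (f v) (f' w)) ∧ (∃ w ∈ S', ¬ G.Adj (f v) (f' w)) := by
  intro v hv
  refine ⟨?_, exists_nonadj_dart_clique_side h hfree f' S' hS' hSK' hSI' (hSI v hv)⟩
  by_contra! hnone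
  obtain ⟨u, hu, huv⟩ : ∃ u, u ∈ Sᶜ ∧ u ≠ v :=
    Finset.exists_mem_ne (by simp [Finset.card_compl, hS]) v
  rw [Finset.mem_compl] at hu
  obtain ⟨w, hw, huw⟩ :=
    exists_nonadj_dart_clique_side h hfree f' S' hS' hSK' hSI' (hSI u hu)
  exact huw (adj_of_not_adj_dart_independent_side h hfree f S hS hSK hSI (hSK' w hw)
    (fun hr => Set.disjoint_left.1 hdisj hr ⟨w, rfl⟩) hv hu huv.symm (hnone w hw))
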